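/- Let d ≥ 1 and 0 ≤ m < d be integers. There exists a constant f(d,m) > 0 depending only on d and m with the following property: for every positive integer n and every coloring of the n^d small cubes of the standard partition of the unit cube with colors from an arbitrary set, if every point x ∈ [0,1]^d lies in closed small cubes of at most m+1 distinct colors, then there exists a monochromatic connected component containing at least f(d,m)·n^{d−m} small cubes. -/

import Mathlib

/-- The closed small cube of the standard partition of `[0,1]^d` into `n^d` cubes
indexed by `a : Fin d → Fin n`, namely `∏_i [a i / n, (a i + 1) / n]`. -/
def smallCube {d n : ℕ} (a : Fin d → Fin n) : Set (Fin d → ℝ) :=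
  {x | ∀ i : Fin d, x i ∈ Set.Icc ((a i : ℝ) / n) (((a i : ℝ) + 1) / n)}

/-- Two small cubes are adjacent iff their closed cubes intersect, i.e. iff
`|a i - b i| ≤ 1` for every coordinate `i`. -/
def cubeAdj {d n : ℕ} (a b : Fin d → Fin n) : Prop :=
  ∀ i : Fin d, (a i : ℤ) ≤ (b i : ℤ) + 1 ∧ (b i : ℤ) ≤ (a i : ℤ) + 1

/-- The monochromatic connected component (for the coloring `χ`) containing the
small cube indexed by `a`: all cubes reachable from `a` by a chain of adjacent
cubes in which consecutive cubes have the same color. -/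
def monoComponent {d n : ℕ} {α : Type*} (χ : (Fin d → Fin n) → α) (a : Fin d → Fin n) :
    Set (Fin d → Fin n) :=
  {b | Relation.ReflTransGen (fun x y => cubeAdj x y ∧ χ x = χ y) a b}

/-! ### Cochains modulo two on lists of vertices -/

section Cochains

variable {V ι : Type*}

/-- The simplicial coboundary of a cochain modulo two; lists of length `k` play the role of
simplices of dimension `k - 1`. -/
def coboundary : (List V → ZMod 2) → List V → ZMod 2
  | _, [] => 0
  | z, a :: l => z l + coboundary (fun l' => z (a :: l')) l

/-- The prism operator between the pullbacks along `f` and `g`. -/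
def prism (f g : V → V) : (List V → ZMod 2) → List V → ZMod 2
  | _, [] => 0
  | z, a :: l => z (f a :: g a :: l.map g) + prism f g (fun l' => z (f a :: l')) l

/-- A cochain is normalized if it vanishes on lists with two equal consecutive entries. -/
def Normalized (z : List V → ZMod 2) : Prop :=
  ∀ l₁ a l₂, z (l₁ ++ a :: a :: l₂) = 0

lemma coboundary_add (z w : List V → ZMod 2) (l : List V) :
    coboundary (fun l' => z l' + w l') l = coboundary z l + coboundary w l := by
  induction l generalizing z w with
  | nil => simp [coboundary]
  | cons a l ih => simp only [coboundary, ih]; ring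

lemma coboundary_zero (l : List V) : coboundary (fun _ => 0) l = 0 := by
  induction l with
  | nil => rfl
  | cons a l ih => simp [coboundary, ih]

lemma coboundary_sum {κ : Type*} (s : Finset κ) (z : κ → List V → ZMod 2) (l : List V) :
    coboundary (fun l' => ∑ i ∈ s, z i l') l = ∑ i ∈ s, coboundary (z i) l := by
  classical
  induction s using Finset.induction_on with
  | empty => simpa using coboundary_zero l
  | insert i s hi ih => simp only [Finset.sum_insert hi, coboundary_add, ih]

lemma coboundary_comp_map (g : V → V) (z : List V → ZMod 2) (l : List V) :
    coboundary (fun l' => z (l'.map g)) l = coboundary z (l.map g) := by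
  induction l generalizing z with
  | nil => rfl
  | cons a l ih => simp only [coboundary, List.map_cons, ← ih]

lemma prism_add (f g : V → V) (z w : List V → ZMod 2) (l : List V) :
    prism f g (fun l' => z l' + w l') l = prism f g z l + prism f g w l := by
  induction l generalizing z w with
  | nil => simp [prism]
  | cons a l ih => simp only [prism, ih]; ring

lemma prism_zero (f g : V → V) (l : List V) : prism f g (fun _ => 0) l = 0 := by
  induction l with
  | nil => rfl
  | cons a l ih => simp [prism, ih]

lemma coboundary_prism_add_prism_coboundary (f g : V → V) (z : List V → ZMod 2) (l : List V) :
    coboundary (prism f g z) l + prism f g (coboundary z) l = z (l.map g) + z (l.map f) := by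
  induction l generalizing z with
  | nil => simp [coboundary, prism, CharTwo.add_self_eq_zero]
  | cons a l ih =>
    have h := ih (fun l' => z (f a :: l'))
    simp only [coboundary, prism, coboundary_add, prism_add, List.map_cons] at h ⊢
    rw [coboundary_comp_map g (fun l' => z (f a :: g a :: l'))]
    have h2 : ∀ x : ZMod 2, x + x = 0 := CharTwo.add_self_eq_zero
    linear_combination h + h2 (prism f g z l) + h2 (z (f a :: l.map g)) +
      h2 (coboundary (fun l' => z (f a :: g a :: l')) (l.map g))

lemma Normalized.prism {z : List V → ZMod 2} (hz : Normalized z) (f g : V → V) :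
    Normalized (prism f g z) := by
  intro l₁ a l₂
  induction l₁ generalizing z with
  | nil =>
    have h1 := hz [f a] (g a) (l₂.map g)
    have h2 := hz [] (f a) (g a :: l₂.map g)
    have h3 : (fun l' => z (f a :: f a :: l')) = fun _ => 0 := funext fun l' => hz [] (f a) l'
    simp only [List.cons_append, List.nil_append] at h1 h2
    simp [_root_.prism, h1, h2, h3, prism_zero]
  | cons b l₁ ih =>
    have h1 := hz (f b :: g b :: l₁.map g) (g a) (l₂.map g)
    have h2 := @ih (fun l' => z (f b :: l')) fun m₁ x m₂ => hz (f b :: m₁) x m₂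
    simp only [List.cons_append] at h1
    simp [_root_.prism, h1, h2]

lemma Normalized.replicate {z : List V → ZMod 2} (hz : Normalized z) (p : V) {k : ℕ}
    (hk : 2 ≤ k) : z (List.replicate k p) = 0 := by
  obtain ⟨k, rfl⟩ := Nat.exists_eq_add_of_le' hk
  exact hz [] p (List.replicate k p)

lemma exists_of_prism_ne_zero {f g : V → V} {z : List V → ZMod 2} {l : List V}
    (h : prism f g z l ≠ 0) :
    ∃ l', l'.length = l.length + 1 ∧ (∀ x ∈ l', ∃ y ∈ l, x = f y ∨ x = g y) ∧
      (∀ a ∈ l.head?, f a ∈ l'.head?) ∧ z l' ≠ 0 := by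
  induction l generalizing z with
  | nil => exact absurd rfl h
  | cons a l ih =>
    by_cases h0 : z (f a :: g a :: l.map g) = 0
    · rw [prism, h0, zero_add] at h
      obtain ⟨l', hlen, hmem, -, hne⟩ := ih h
      refine ⟨f a :: l', by simp [hlen], ?_, by simp, hne⟩
      intro x hx
      rcases List.mem_cons.1 hx with rfl | hx
      · exact ⟨a, by simp, Or.inl rfl⟩
      · obtain ⟨y, hy, hxy⟩ := hmem x hx
        exact ⟨y, List.mem_cons_of_mem _ hy, hxy⟩
    · refine ⟨_, by simp, ?_, by simp, h0⟩
      intro x hx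
      simp only [List.mem_cons, List.mem_map] at hx
      rcases hx with rfl | rfl | ⟨y, hy, rfl⟩
      · exact ⟨a, by simp, Or.inl rfl⟩
      · exact ⟨a, by simp, Or.inr rfl⟩
      · exact ⟨y, by simp [hy], Or.inr rfl⟩

/-- The homotopy obtained by stacking the prisms between consecutive maps `π t`, `t ≤ N`. -/
def stackedPrism (π : ℕ → V → V) (N : ℕ) (z : List V → ZMod 2) (l : List V) : ZMod 2 :=
  ∑ t ∈ Finset.range N, prism (π t) (π (t + 1)) z l

lemma coboundary_stackedPrism (π : ℕ → V → V) (N : ℕ) (z : List V → ZMod 2) (l : List V) :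
    coboundary (stackedPrism π N z) l + stackedPrism π N (coboundary z) l =
      z (l.map (π N)) + z (l.map (π 0)) := by
  have h : coboundary (stackedPrism π N z) l =
      ∑ t ∈ Finset.range N, coboundary (prism (π t) (π (t + 1)) z) l :=
    coboundary_sum _ _ _
  rw [h, stackedPrism, ← Finset.sum_add_distrib]
  simp only [coboundary_prism_add_prism_coboundary]
  simp only [← CharTwo.sub_eq_add (R := ZMod 2)]
  exact Finset.sum_range_sub (fun t => z (l.map (π t))) N

lemma Normalized.stackedPrism {z : List V → ZMod 2} (hz : Normalized z) (π : ℕ → V → V)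
    (N : ℕ) : Normalized (stackedPrism π N z) := fun l₁ a l₂ =>
  Finset.sum_eq_zero fun t _ => hz.prism (π t) (π (t + 1)) l₁ a l₂

/-- The pullback under the labelling `c` of the simplicial cochain dual to the simplex `σ`. -/
noncomputable def dualCochain [DecidableEq ι] (c : V → ι) (σ : Finset ι) (l : List V) : ZMod 2 :=
  if ((l.map c : List ι) : Multiset ι) = σ.val then 1 else 0

lemma dualCochain_cons [DecidableEq ι] (c : V → ι) (σ : Finset ι) (a : V) (l : List V) :
    dualCochain c σ (a :: l) = if c a ∈ σ then dualCochain c (σ.erase (c a)) l else 0 := by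
  have key : (((a :: l).map c : List ι) : Multiset ι) = σ.val ↔
      c a ∈ σ ∧ ((l.map c : List ι) : Multiset ι) = (σ.erase (c a)).val := by
    rw [List.map_cons, ← Multiset.cons_coe, Finset.erase_val]
    constructor
    · intro h
      refine ⟨?_, ?_⟩
      · rw [← Finset.mem_val, ← h]; exact Multiset.mem_cons_self _ _
      · rw [← h, Multiset.erase_cons_head]
    · rintro ⟨h1, h2⟩
      rw [h2, Multiset.cons_erase h1]
  unfold dualCochain
  simp only [key]
  split_ifs <;> simp_all

lemma mem_of_dualCochain_ne_zero [DecidableEq ι] {c : V → ι} {σ : Finset ι} {l : List V}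
    (h : dualCochain c σ l ≠ 0) : σ = (l.map c).toFinset ∧ (l.map c).Nodup := by
  unfold dualCochain at h
  have h' : ((l.map c : List ι) : Multiset ι) = σ.val := by
    by_contra h0; exact h (if_neg h0)
  refine ⟨?_, ?_⟩
  · ext x
    rw [List.mem_toFinset, ← Multiset.mem_coe, h', Finset.mem_val]
  · rw [← Multiset.coe_nodup, h']; exact σ.nodup

lemma normalized_dualCochain [DecidableEq ι] (c : V → ι) (σ : Finset ι) :
    Normalized (dualCochain c σ) := by
  intro l₁ a l₂
  by_contra h
  have := (mem_of_dualCochain_ne_zero h).2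
  simp [List.nodup_append] at this

lemma coboundary_dualCochain [Fintype ι] [DecidableEq ι] (c : V → ι) (σ : Finset ι)
    (l : List V) :
    coboundary (dualCochain c σ) l = ∑ v ∈ σᶜ, dualCochain c (insert v σ) l := by
  induction l generalizing σ with
  | nil =>
    refine (Finset.sum_eq_zero fun v _ => ?_).symm
    by_contra h
    have := (mem_of_dualCochain_ne_zero h).1
    simp at this
  | cons a l ih =>
    simp only [coboundary, dualCochain_cons]
    by_cases ha : c a ∈ σ
    · have hc : (σ.erase (c a))ᶜ = insert (c a) σᶜ := by
        ext x; simp only [Finset.mem_compl, Finset.mem_erase, Finset.mem_insert]; tauto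
      simp only [ha, if_true, Finset.mem_insert, or_true]
      rw [ih, hc, Finset.sum_insert (by simpa using ha), Finset.insert_erase ha, ← add_assoc,
        CharTwo.add_self_eq_zero, zero_add]
      refine Finset.sum_congr rfl fun v hv => ?_
      rw [Finset.erase_insert_of_ne]
      rintro rfl
      exact Finset.mem_compl.1 hv ha
    · simp only [ha, if_false, coboundary_zero, add_zero, Finset.mem_insert, or_false]
      rw [Finset.sum_ite, Finset.sum_const_zero, add_zero,
        show {x ∈ σᶜ | c a = x} = {c a} by ext x; simp; grind]
      simp [Finset.erase_insert ha]

lemma sum_sum_insert_insert [Fintype ι] [DecidableEq ι] (G : Finset ι → ZMod 2)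
    (σ : Finset ι) : ∑ v ∈ σᶜ, ∑ u ∈ (insert v σ)ᶜ, G (insert u (insert v σ)) = 0 := by
  rw [Finset.sum_sigma']
  refine Finset.sum_involution (fun x _ => ⟨x.2, x.1⟩) ?_ ?_ ?_ ?_
  · rintro ⟨v, u⟩ -
    rw [Finset.insert_comm, CharTwo.add_self_eq_zero]
  · rintro ⟨v, u⟩ h - h'
    simp at h h'
    grind
  · rintro ⟨v, u⟩ h
    simp at h ⊢
    grind
  · rintro ⟨v, u⟩ -
    rfl

end Cochains

/-! ### Counting lists -/

section Counting

variable {V ι : Type*}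

open Classical in
/-- The neighbours of a vertex. -/
noncomputable def ball [Fintype V] (adj : V → V → Prop) (a : V) : Finset V := {b | adj a b}

lemma mem_ball [Fintype V] {adj : V → V → Prop} {a b : V} : b ∈ ball adj a ↔ adj a b := by
  simp [ball]

open Classical in
/-- The vertices whose neighbourhood meets every class in `σ`. -/
noncomputable def nearVertices [Fintype V] (adj : V → V → Prop) (c : V → ι) (σ : Finset ι) :
    Finset V :=
  {a | ∀ v ∈ σ, ∃ b, adj a b ∧ c b = v}

lemma mem_nearVertices [Fintype V] {adj : V → V → Prop} {c : V → ι} {σ : Finset ι} {a : V} :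
    a ∈ nearVertices adj c σ ↔ ∀ v ∈ σ, ∃ b, adj a b ∧ c b = v := by
  simp [nearVertices]

lemma sum_card_nearVertices_insert_le [Fintype V] [Fintype ι] [DecidableEq ι]
    {adj : V → V → Prop} {D : ℕ} (hD : ∀ a, (ball adj a).card ≤ D) (c : V → ι)
    (σ : Finset ι) :
    ∑ v ∈ σᶜ, (nearVertices adj c (insert v σ)).card ≤ D * (nearVertices adj c σ).card := by
  classical
  rw [← Finset.card_sigma]
  calc _ ≤ ((nearVertices adj c σ).sigma fun a => ball adj a).card := by
        refine (Finset.card_le_card fun x hx => ?_).trans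
          (Finset.card_image_le (f := fun y : (_ : V) × V => (⟨c y.2, y.1⟩ : (_ : ι) × V)))
        obtain ⟨v, a⟩ := x
        simp only [Finset.mem_sigma, mem_nearVertices, Finset.mem_image, mem_ball] at hx ⊢
        obtain ⟨b, hb, rfl⟩ := hx.2 v (Finset.mem_insert_self _ _)
        exact ⟨⟨a, b⟩, ⟨fun u hu => hx.2 u (Finset.mem_insert_of_mem hu), hb⟩, rfl⟩
    _ ≤ ∑ a ∈ nearVertices adj c σ, D := by
        rw [Finset.card_sigma]; exact Finset.sum_le_sum fun a _ => hD a
    _ = _ := by rw [Finset.sum_const, smul_eq_mul, mul_comm]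

lemma card_nearVertices_singleton_le [Fintype V] [DecidableEq ι] {adj : V → V → Prop} {D : ℕ}
    (hsymm : ∀ a b, adj a b → adj b a) (hD : ∀ a, (ball adj a).card ≤ D) (c : V → ι) (v : ι) :
    (nearVertices adj c {v}).card ≤ D * ({a | c a = v} : Finset V).card := by
  classical
  calc _ ≤ (({a | c a = v} : Finset V).biUnion fun a => ball adj a).card := by
        refine Finset.card_le_card fun a ha => ?_
        obtain ⟨b, hb, hv⟩ := mem_nearVertices.1 ha v (by simp)
        simp only [Finset.mem_biUnion, Finset.mem_filter, Finset.mem_univ, true_and, mem_ball]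
        exact ⟨b, hv, hsymm _ _ hb⟩
    _ ≤ ∑ a ∈ ({a | c a = v} : Finset V), D :=
        Finset.card_biUnion_le.trans (Finset.sum_le_sum fun a _ => hD a)
    _ = _ := by rw [Finset.sum_const, smul_eq_mul, mul_comm]

variable [DecidableEq V]

/-- The lists of length `k` with entries in `S`. -/
def listsIn (S : Finset V) : ℕ → Finset (List V)
  | 0 => {[]}
  | k + 1 => (S ×ˢ listsIn S k).image fun x => x.1 :: x.2

lemma mem_listsIn {S : Finset V} {k : ℕ} {l : List V} :
    l ∈ listsIn S k ↔ l.length = k ∧ ∀ a ∈ l, a ∈ S := by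
  induction k generalizing l with
  | zero => simp only [listsIn, Finset.mem_singleton, List.length_eq_zero_iff]; grind
  | succ k ih =>
    cases l with
    | nil => simp [listsIn]
    | cons a l => simp [listsIn, ih]; tauto

lemma card_listsIn_le (S : Finset V) (k : ℕ) : (listsIn S k).card ≤ S.card ^ k := by
  induction k with
  | zero => simp [listsIn]
  | succ k ih =>
    calc (listsIn S (k + 1)).card ≤ (S ×ˢ listsIn S k).card := Finset.card_image_le
      _ = S.card * (listsIn S k).card := Finset.card_product _ _
      _ ≤ S.card * S.card ^ k := Nat.mul_le_mul_left _ ih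
      _ = S.card ^ (k + 1) := by ring

/-- All entries of the list are pairwise related. -/
def IsBox (adj : V → V → Prop) (l : List V) : Prop :=
  ∀ a ∈ l, ∀ b ∈ l, adj a b

open Classical in
/-- The boxes of length `k` on which the cochain `z` does not vanish. -/
noncomputable def boxSupport [Fintype V] (adj : V → V → Prop) (k : ℕ) (z : List V → ZMod 2) :
    Finset (List V) :=
  {l ∈ listsIn Finset.univ k | IsBox adj l ∧ z l ≠ 0}

lemma mem_boxSupport [Fintype V] {adj : V → V → Prop} {k : ℕ} {z : List V → ZMod 2}
    {l : List V} : l ∈ boxSupport adj k z ↔ l.length = k ∧ IsBox adj l ∧ z l ≠ 0 := by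
  simp [boxSupport, mem_listsIn]

lemma card_boxSupport_add_sum_le [Fintype V] {κ : Type*} (adj : V → V → Prop) (k : ℕ)
    (z : List V → ZMod 2) (s : Finset κ) (w : κ → List V → ZMod 2) :
    (boxSupport adj k fun l => z l + ∑ i ∈ s, w i l).card ≤
      (boxSupport adj k z).card + ∑ i ∈ s, (boxSupport adj k (w i)).card := by
  classical
  calc _ ≤ (boxSupport adj k z ∪ s.biUnion fun i => boxSupport adj k (w i)).card := by
        refine Finset.card_le_card fun l hl => ?_
        simp only [Finset.mem_union, Finset.mem_biUnion, mem_boxSupport] at hl ⊢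
        obtain ⟨h1, h2, h3⟩ := hl
        by_cases hz : z l = 0
        · rw [hz, zero_add] at h3
          obtain ⟨i, hi, hne⟩ := Finset.exists_ne_zero_of_sum_ne_zero h3
          exact Or.inr ⟨i, hi, h1, h2, hne⟩
        · exact Or.inl ⟨h1, h2, hz⟩
    _ ≤ _ := (Finset.card_union_le _ _).trans (Nat.add_le_add_left Finset.card_biUnion_le _)

lemma card_boxSupport_dualCochain_le [Fintype V] [DecidableEq ι] {adj : V → V → Prop} {D : ℕ}
    (hD : ∀ a, (ball adj a).card ≤ D) (c : V → ι) (σ : Finset ι) (k : ℕ) :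
    (boxSupport adj (k + 1) (dualCochain c σ)).card ≤
      D ^ k * (nearVertices adj c σ).card := by
  classical
  calc _ ≤ ((nearVertices adj c σ).biUnion fun a =>
          (listsIn (ball adj a) k).image fun l => a :: l).card := by
        refine Finset.card_le_card fun l hl => ?_
        obtain ⟨h1, h2, h3⟩ := mem_boxSupport.1 hl
        cases l with
        | nil => simp at h1
        | cons a l =>
          simp only [Finset.mem_biUnion, Finset.mem_image, mem_nearVertices, mem_listsIn,
            mem_ball]
          refine ⟨a, fun v hv => ?_, l, ⟨by simpa using h1, fun b hb =>
            h2 a (by simp) b (by simp [hb])⟩, rfl⟩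
          rw [(mem_of_dualCochain_ne_zero h3).1, List.mem_toFinset, List.mem_map] at hv
          obtain ⟨b, hb, rfl⟩ := hv
          exact ⟨b, h2 a (by simp) b hb, rfl⟩
    _ ≤ ∑ a ∈ nearVertices adj c σ, D ^ k := Finset.card_biUnion_le.trans <|
        Finset.sum_le_sum fun a _ => Finset.card_image_le.trans <|
          (card_listsIn_le _ _).trans (Nat.pow_le_pow_left (hD a) k)
    _ = _ := by rw [Finset.sum_const, smul_eq_mul, mul_comm]

end Counting

/-! ### Filling cocycles and the abstract coloring theorem -/

section Filling

variable {V ι : Type*} [DecidableEq V] [Fintype V]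

/-- Contractions of a finite graph to each of its points `p`, in `N` steps: the graph has degrees
at most `D`, simplices stay simplices along the contraction, and an average choice of `p` sends at
most `E` points to a given point at a given time. -/
structure IsContractionFamily (adj : V → V → Prop) (π : V → ℕ → V → V) (N D E : ℕ) : Prop where
  refl : ∀ a, adj a a
  symm : ∀ a b, adj a b → adj b a
  degree : ∀ a, (ball adj a).card ≤ D
  start : ∀ p a, π p 0 a = p
  finish : ∀ p a, π p N a = a
  adj_same : ∀ p t a b, adj a b → adj (π p t a) (π p t b)
  adj_next : ∀ p t a b, adj a b → adj (π p t a) (π p (t + 1) b)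
  fiber : ∀ t b, ({x | π x.1 t x.2 = b} : Finset (V × V)).card ≤ E * Fintype.card V

variable {adj : V → V → Prop} {π : V → ℕ → V → V} {N D E : ℕ}

lemma IsContractionFamily.isBox_prism (h : IsContractionFamily adj π N D E) {p : V} {t : ℕ}
    {l l' : List V} (hl : IsBox adj l)
    (hmem : ∀ x ∈ l', ∃ y ∈ l, x = π p t y ∨ x = π p (t + 1) y) : IsBox adj l' := by
  intro x hx y hy
  obtain ⟨a, ha, rfl | rfl⟩ := hmem x hx <;> obtain ⟨b, hb, rfl | rfl⟩ := hmem y hy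
  · exact h.adj_same _ _ _ _ (hl a ha b hb)
  · exact h.adj_next _ _ _ _ (hl a ha b hb)
  · exact h.symm _ _ (h.adj_next _ _ _ _ (hl b hb a ha))
  · exact h.adj_same _ _ _ _ (hl a ha b hb)

lemma sum_card_boxSupport_stackedPrism_le (h : IsContractionFamily adj π N D E) (k : ℕ)
    (z : List V → ZMod 2) :
    ∑ p, (boxSupport adj (k + 1) (stackedPrism (π p) N z)).card ≤
      N * (boxSupport adj (k + 2) z).card * (E * Fintype.card V * D ^ k) := by
  rw [← Finset.card_sigma]
  let F : ℕ × List V → Finset ((_ : V) × List V) := fun y =>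
    ((({x | π x.1 y.1 x.2 ∈ y.2.head?} : Finset (V × V)).sigma
      fun x => listsIn (ball adj x.2) k).image fun x => ⟨x.1.1, x.1.2 :: x.2⟩)
  have hF : ∀ y ∈ Finset.range N ×ˢ boxSupport adj (k + 2) z,
      (F y).card ≤ E * Fintype.card V * D ^ k := by
    rintro ⟨t, l'⟩ hy
    obtain ⟨b, l', rfl⟩ : ∃ b l, l' = b :: l := by
      have := (mem_boxSupport.1 (Finset.mem_product.1 hy).2).1
      cases l' with
      | nil => simp at this
      | cons b l => exact ⟨b, l, rfl⟩
    refine Finset.card_image_le.trans ?_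
    rw [Finset.card_sigma]
    refine (Finset.sum_le_sum fun x _ =>
      (card_listsIn_le _ _).trans (Nat.pow_le_pow_left (h.degree x.2) k)).trans ?_
    rw [Finset.sum_const, smul_eq_mul]
    refine Nat.mul_le_mul_right _ ?_
    simpa [eq_comm] using h.fiber t b
  calc _ ≤ ((Finset.range N ×ˢ boxSupport adj (k + 2) z).biUnion F).card := by
        refine Finset.card_le_card ?_
        rintro ⟨p, l⟩ hl
        obtain ⟨hlen, hbox, hne⟩ := mem_boxSupport.1 (Finset.mem_sigma.1 hl).2
        obtain ⟨t, ht, hne⟩ := Finset.exists_ne_zero_of_sum_ne_zero hne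
        obtain ⟨l', hlen', hmem, hhead, hz⟩ := exists_of_prism_ne_zero hne
        refine Finset.mem_biUnion.2 ⟨(t, l'), Finset.mem_product.2 ⟨ht, mem_boxSupport.2
          ⟨by rw [hlen', hlen], h.isBox_prism hbox hmem, hz⟩⟩, ?_⟩
        cases l with
        | nil => simp at hlen
        | cons a l =>
          refine Finset.mem_image.2 ⟨⟨(p, a), l⟩, Finset.mem_sigma.2 ⟨?_, mem_listsIn.2
            ⟨by simpa using hlen, fun b hb => mem_ball.2 (hbox a (by simp) b (by simp [hb]))⟩⟩,
            rfl⟩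
          simpa using hhead
    _ ≤ ∑ y ∈ Finset.range N ×ˢ boxSupport adj (k + 2) z, E * Fintype.card V * D ^ k :=
        Finset.card_biUnion_le.trans (Finset.sum_le_sum hF)
    _ = _ := by rw [Finset.sum_const, smul_eq_mul, Finset.card_product, Finset.card_range]

lemma exists_filling [Nonempty V] (h : IsContractionFamily adj π N D E) (k : ℕ)
    {z : List V → ZMod 2} (hz : Normalized z)
    (hcocycle : ∀ l, l.length = k + 3 → IsBox adj l → coboundary z l = 0) :
    ∃ g : List V → ZMod 2, Normalized g ∧
      (∀ l, l.length = k + 2 → IsBox adj l → coboundary g l = z l) ∧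
      (boxSupport adj (k + 1) g).card ≤ N * (boxSupport adj (k + 2) z).card * (E * D ^ k) := by
  obtain ⟨p, -, hp⟩ := Finset.exists_le_of_sum_le (s := Finset.univ)
    (f := fun p => (boxSupport adj (k + 1) (stackedPrism (π p) N z)).card)
    (g := fun _ => N * (boxSupport adj (k + 2) z).card * (E * D ^ k)) Finset.univ_nonempty (by
      refine (sum_card_boxSupport_stackedPrism_le h k z).trans_eq ?_
      rw [Finset.sum_const, smul_eq_mul, Finset.card_univ]
      ring)
  refine ⟨stackedPrism (π p) N z, hz.stackedPrism _ _, fun l hlen hbox => ?_, hp⟩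
  have key := coboundary_stackedPrism (π p) N z l
  have h0 : stackedPrism (π p) N (coboundary z) l = 0 := by
    refine Finset.sum_eq_zero fun t _ => ?_
    by_contra hne
    obtain ⟨l', hlen', hmem, -, hne'⟩ := exists_of_prism_ne_zero hne
    exact hne' (hcocycle l' (by rw [hlen', hlen]) (h.isBox_prism hbox hmem))
  have h1 : l.map (π p N) = l := List.map_id'' (h.finish p) l
  have h2 : l.map (π p 0) = List.replicate (k + 2) p := by
    rw [← hlen, ← List.map_const']
    exact List.map_congr_left fun a _ => h.start p a
  rwa [h0, h1, h2, hz.replicate p (by omega), add_zero, add_zero] at key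

/-- The constant in the bound on the support of the `j`-th stage of the descent. -/
def descentConst (D E m : ℕ) : ℕ → ℕ
  | 0 => D ^ m
  | j + 1 => D ^ m * (1 + E * D * descentConst D E m j)

variable [Fintype ι] [DecidableEq ι]

/-- A closed family of small cochains on the simplices with `k + 1` vertices of the nerve,
cohomologous to the pulled back dual cochains. -/
structure IsSmallFamily (adj : V → V → Prop) (c : V → ι) (B k : ℕ)
    (w : Finset ι → List V → ZMod 2) : Prop where
  normalized : ∀ σ, σ.card = k + 1 → Normalized (w σ)
  cocycle : ∀ σ, σ.card = k + 1 → ∀ l, l.length = k + 2 → IsBox adj l → coboundary (w σ) l = 0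
  small : ∀ σ, σ.card = k + 1 →
    (boxSupport adj (k + 1) (w σ)).card ≤ B * (nearVertices adj c σ).card
  sum_eq : ∀ ρ, ρ.card = k → ∀ l, l.length = k + 1 → IsBox adj l →
    ∑ v ∈ ρᶜ, w (insert v ρ) l = coboundary (dualCochain c ρ) l

lemma isSmallFamily_dualCochain (hD : ∀ a, (ball adj a).card ≤ D) {c : V → ι} {m : ℕ}
    (hc : ∀ l, IsBox adj l → (l.map c).toFinset.card ≤ m + 1) :
    IsSmallFamily adj c (D ^ m) m (dualCochain c) where
  normalized σ _ := normalized_dualCochain c σ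
  cocycle σ hσ l _ hbox := by
    rw [coboundary_dualCochain]
    refine Finset.sum_eq_zero fun v hv => ?_
    by_contra hne
    have := hc l hbox
    rw [← (mem_of_dualCochain_ne_zero hne).1,
      Finset.card_insert_of_notMem (Finset.mem_compl.1 hv)] at this
    omega
  small σ _ := card_boxSupport_dualCochain_le hD c σ m
  sum_eq ρ _ l _ _ := (coboundary_dualCochain c ρ l).symm

lemma IsSmallFamily.descend [Nonempty V] (h : IsContractionFamily adj π N D E) {c : V → ι}
    {B k : ℕ} {w : Finset ι → List V → ZMod 2} (hw : IsSmallFamily adj c B (k + 1) w) :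
    ∃ w', IsSmallFamily adj c (D ^ k + N * B * (E * D ^ k) * D) k w' := by
  have hfill : ∀ σ : Finset ι, ∃ g : List V → ZMod 2, σ.card = k + 2 → Normalized g ∧
      (∀ l, l.length = k + 2 → IsBox adj l → coboundary g l = w σ l) ∧
      (boxSupport adj (k + 1) g).card ≤
        N * (boxSupport adj (k + 2) (w σ)).card * (E * D ^ k) := fun σ => by
    by_cases hσ : σ.card = k + 2
    · obtain ⟨g, hg⟩ := exists_filling h k (hw.normalized σ hσ) (hw.cocycle σ hσ)
      exact ⟨g, fun _ => hg⟩
    · exact ⟨0, fun hσ' => absurd hσ' hσ⟩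
  choose G hG using hfill
  have hcard : ∀ {ρ : Finset ι} {v : ι} {j : ℕ}, ρ.card = j → v ∈ ρᶜ →
      (insert v ρ).card = j + 1 := fun hρ hv => by
    rw [Finset.card_insert_of_notMem (Finset.mem_compl.1 hv), hρ]
  refine ⟨fun ρ l => dualCochain c ρ l + ∑ v ∈ ρᶜ, G (insert v ρ) l, ?_, ?_, ?_, ?_⟩
  · intro ρ hρ l₁ a l₂
    simp only [normalized_dualCochain c ρ l₁ a l₂, zero_add]
    exact Finset.sum_eq_zero fun v hv => (hG _ (hcard hρ hv)).1 l₁ a l₂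
  · intro ρ hρ l hlen hbox
    rw [coboundary_add, coboundary_sum, ← hw.sum_eq ρ hρ l hlen hbox,
      ← Finset.sum_add_distrib]
    refine Finset.sum_eq_zero fun v hv => ?_
    rw [(hG _ (hcard hρ hv)).2.1 l hlen hbox, CharTwo.add_self_eq_zero]
  · intro ρ hρ
    calc _ ≤ _ := card_boxSupport_add_sum_le adj (k + 1) (dualCochain c ρ) ρᶜ
          fun v => G (insert v ρ)
      _ ≤ D ^ k * (nearVertices adj c ρ).card +
          ∑ v ∈ ρᶜ, N * B * (E * D ^ k) * (nearVertices adj c (insert v ρ)).card := by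
        refine Nat.add_le_add (card_boxSupport_dualCochain_le h.degree c ρ k)
          (Finset.sum_le_sum fun v hv => (hG _ (hcard hρ hv)).2.2.trans ?_)
        calc _ ≤ N * (B * (nearVertices adj c (insert v ρ)).card) * (E * D ^ k) := by
              gcongr
              exact hw.small _ (hcard hρ hv)
          _ = _ := by ring
      _ ≤ D ^ k * (nearVertices adj c ρ).card +
          N * B * (E * D ^ k) * (D * (nearVertices adj c ρ).card) := by
        rw [← Finset.mul_sum]
        gcongr
        exact sum_card_nearVertices_insert_le h.degree c ρ
      _ = _ := by ring
  · intro ρ _ l _ _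
    rw [Finset.sum_add_distrib, sum_sum_insert_insert (fun σ => G σ l), add_zero,
      coboundary_dualCochain]

lemma exists_isSmallFamily [Nonempty V] (h : IsContractionFamily adj π N D E) (hN : 1 ≤ N)
    (hD : 1 ≤ D) {c : V → ι} {m : ℕ}
    (hc : ∀ l, IsBox adj l → (l.map c).toFinset.card ≤ m + 1) {j k : ℕ} (hjk : j + k = m) :
    ∃ w, IsSmallFamily adj c (descentConst D E m j * N ^ j) k w := by
  induction j generalizing k with
  | zero =>
    obtain rfl : k = m := by omega
    exact ⟨_, by simpa [descentConst] using isSmallFamily_dualCochain h.degree hc⟩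
  | succ j ih =>
    obtain ⟨w, hw⟩ := ih (k := k + 1) (by omega)
    obtain ⟨w', hw'⟩ := hw.descend h
    refine ⟨w', hw'.normalized, hw'.cocycle, fun σ hσ => (hw'.small σ hσ).trans ?_, hw'.sum_eq⟩
    refine Nat.mul_le_mul_right _ ?_
    have hDk : D ^ k ≤ D ^ m := Nat.pow_le_pow_right hD (by omega)
    have hNj : 1 ≤ N ^ (j + 1) := Nat.one_le_pow _ _ hN
    calc _ ≤ D ^ m * N ^ (j + 1) +
          N * (descentConst D E m j * N ^ j) * (E * D ^ m) * D := by
          gcongr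
          exact hDk.trans (Nat.le_mul_of_pos_right _ hNj)
      _ = _ := by rw [descentConst]; ring

/-- If every box meets at most `m + 1` classes of `c`, then one of the classes is large. -/
theorem exists_large_class [Nonempty V] (h : IsContractionFamily adj π N D E) (hN : 1 ≤ N)
    (hD : 1 ≤ D) {c : V → ι} {m : ℕ}
    (hc : ∀ l, IsBox adj l → (l.map c).toFinset.card ≤ m + 1) :
    ∃ v, Fintype.card V ≤
      descentConst D E m m * N ^ m * (D * ({a | c a = v} : Finset V).card) := by
  obtain ⟨w, hw⟩ := exists_isSmallFamily h hN hD hc (j := m) (k := 0) (by omega)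
  obtain ⟨a⟩ := ‹Nonempty V›
  have hsum := hw.sum_eq ∅ rfl [a] rfl (by simpa [IsBox] using h.refl a)
  have hone : coboundary (dualCochain c ∅) [a] = 1 := by simp [coboundary, dualCochain]
  obtain ⟨v, -, hv⟩ := Finset.exists_ne_zero_of_sum_ne_zero (hsum.trans hone ▸ one_ne_zero)
  have hcard : (insert v ∅ : Finset ι).card = 0 + 1 := rfl
  have hadj : ∀ x y, adj x y → w (insert v ∅) [x] = w (insert v ∅) [y] := fun x y hxy => by
    have := hw.cocycle _ hcard [x, y] rfl (by
      simp [IsBox, hxy, h.refl, h.symm _ _ hxy])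
    simp only [coboundary, add_zero] at this
    exact (CharTwo.add_eq_zero.1 this).symm
  have hpath : ∀ p t, w (insert v ∅) [π p t a] = w (insert v ∅) [p] := fun p t => by
    induction t with
    | zero => rw [h.start]
    | succ t ih => rw [← ih, hadj _ _ (h.adj_next p t a a (h.refl a))]
  have hne : ∀ p, w (insert v ∅) [p] ≠ 0 := fun p => by
    rwa [← hpath p N, h.finish]
  refine ⟨v, ?_⟩
  calc Fintype.card V = (Finset.univ.image fun p : V => [p]).card := by
        rw [Finset.card_image_of_injective _ List.singleton_injective, Finset.card_univ]
    _ ≤ (boxSupport adj (0 + 1) (w (insert v ∅))).card := by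
        refine Finset.card_le_card fun l hl => ?_
        obtain ⟨p, -, rfl⟩ := Finset.mem_image.1 hl
        exact mem_boxSupport.2 ⟨rfl, by simpa [IsBox] using h.refl p, hne p⟩
    _ ≤ _ := hw.small _ hcard
    _ ≤ _ := Nat.mul_le_mul_left _ (card_nearVertices_singleton_le h.symm h.degree c v)

end Filling

/-! ### The grid -/

section Grid

variable {d n : ℕ}

/-- Clamping `a` to the interval of radius `t` around `p`. -/
def clampFin (p : Fin n) (t : ℕ) (a : Fin n) : Fin n :=
  ⟨max (p - t) (min (p + t) a), by omega⟩

/-- Clamping a grid point to the cube of radius `t` around `p`. -/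
def gridClamp (p : Fin d → Fin n) (t : ℕ) (a : Fin d → Fin n) : Fin d → Fin n :=
  fun i => clampFin (p i) t (a i)

lemma card_clampFin_fiber_le (t : ℕ) (b : Fin n) :
    ({z | clampFin z.1 t z.2 = b} : Finset (Fin n × Fin n)).card ≤ 3 * n := by
  have hsub : ({z | clampFin z.1 t z.2 = b} : Finset (Fin n × Fin n)) ⊆
      ({z | z.2 = b} : Finset (Fin n × Fin n)) ∪ (({z | (z.1 : ℕ) + t = b} : Finset _) ∪
        ({z | (z.1 : ℕ) = b + t} : Finset _)) := by
    rintro ⟨x, y⟩ hz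
    simp only [clampFin, Finset.mem_filter, Finset.mem_univ, true_and, Fin.ext_iff,
      Finset.mem_union] at hz ⊢
    omega
  have h1 : ({z | z.2 = b} : Finset (Fin n × Fin n)).card ≤ n := by
    refine (Finset.card_le_card_of_injOn Prod.fst (t := Finset.univ) (by simp) ?_).trans
      (by simp)
    rintro ⟨x, y⟩ hx ⟨x', y'⟩ hx' h
    simp_all
  have h2 : ∀ P : Fin n → Prop, ∀ _ : DecidablePred P, (∀ x x', P x → P x' → x = x') →
      ({z | P z.1} : Finset (Fin n × Fin n)).card ≤ n := by
    intro P _ hP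
    refine (Finset.card_le_card_of_injOn Prod.snd (t := Finset.univ) (by simp) ?_).trans
      (by simp)
    rintro ⟨x, y⟩ hx ⟨x', y'⟩ hx' h
    simp only [Finset.coe_filter, Finset.mem_univ, true_and, Set.mem_ofPred_eq] at hx hx' h
    rw [hP x x' hx hx', h]
  refine (Finset.card_le_card hsub).trans ((Finset.card_union_le _ _).trans ?_)
  have h3 := Finset.card_union_le ({z | (z.1 : ℕ) + t = b} : Finset (Fin n × Fin n))
    {z | (z.1 : ℕ) = b + t}
  have h4 := h2 (fun x => (x : ℕ) + t = b) inferInstance fun x x' h h' => Fin.ext (by omega)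
  have h5 := h2 (fun x => (x : ℕ) = b + t) inferInstance fun x x' h h' => Fin.ext (by omega)
  omega

lemma card_ball_cubeAdj_le (a : Fin d → Fin n) : (ball cubeAdj a).card ≤ 3 ^ d := by
  have hsub : ball cubeAdj a ⊆ Fintype.piFinset fun i =>
      ({y | (a i : ℤ) ≤ (y : ℤ) + 1 ∧ (y : ℤ) ≤ (a i : ℤ) + 1} : Finset (Fin n)) := by
    intro b hb
    simpa [Fintype.mem_piFinset, cubeAdj] using mem_ball.1 hb
  refine (Finset.card_le_card hsub).trans ?_
  rw [Fintype.card_piFinset]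
  refine (Finset.prod_le_pow_card _ _ 3 fun i _ => ?_).trans (by simp)
  calc _ ≤ (Finset.Icc ((a i : ℤ) - 1) ((a i : ℤ) + 1)).card := by
        refine Finset.card_le_card_of_injOn (fun y : Fin n => (y : ℤ)) ?_ ?_
        · intro y hy
          simp at hy ⊢
          omega
        · intro x _ y _ h
          exact Fin.ext (by simpa using h)
    _ ≤ 3 := by rw [Int.card_Icc]; omega

lemma card_gridClamp_fiber_le (t : ℕ) (b : Fin d → Fin n) :
    ({x | gridClamp x.1 t x.2 = b} : Finset ((Fin d → Fin n) × (Fin d → Fin n))).card ≤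
      3 ^ d * Fintype.card (Fin d → Fin n) := by
  calc _ ≤ (Fintype.piFinset fun i =>
          ({z | clampFin z.1 t z.2 = b i} : Finset (Fin n × Fin n))).card := by
        refine Finset.card_le_card_of_injOn (fun x i => (x.1 i, x.2 i)) ?_ ?_
        · intro x hx
          have hx : gridClamp x.1 t x.2 = b := by simpa using hx
          simpa [Fintype.mem_piFinset, gridClamp] using fun i => congrFun hx i
        · rintro ⟨p, a⟩ _ ⟨p', a'⟩ _ h
          simp only [funext_iff, Prod.mk.injEq] at h
          exact Prod.ext (funext fun i => (h i).1) (funext fun i => (h i).2)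
    _ ≤ ∏ _i : Fin d, 3 * n := by
        rw [Fintype.card_piFinset]
        exact Finset.prod_le_prod' fun i _ => card_clampFin_fiber_le t (b i)
    _ = _ := by simp [mul_pow]

lemma isContractionFamily_gridClamp :
    IsContractionFamily (cubeAdj (d := d) (n := n)) gridClamp n (3 ^ d) (3 ^ d) where
  refl a i := by omega
  symm a b h i := (h i).symm
  degree := card_ball_cubeAdj_le
  start p a := funext fun i => Fin.ext (by simp only [gridClamp, clampFin]; omega)
  finish p a := funext fun i => Fin.ext (by simp only [gridClamp, clampFin]; omega)
  adj_same p t a b h i := by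
    have := h i
    simp only [gridClamp, clampFin]
    omega
  adj_next p t a b h i := by
    have := h i
    simp only [gridClamp, clampFin]
    omega
  fiber := card_gridClamp_fiber_le

variable {α : Type*}

lemma mem_monoComponent_self (χ : (Fin d → Fin n) → α) (a : Fin d → Fin n) :
    a ∈ monoComponent χ a :=
  Relation.ReflTransGen.refl

lemma monoComponent_eq_of_adj {χ : (Fin d → Fin n) → α} {a b : Fin d → Fin n}
    (h : cubeAdj a b) (hχ : χ a = χ b) : monoComponent χ a = monoComponent χ b := by
  ext x
  exact ⟨fun hx => Relation.ReflTransGen.head ⟨fun i => (h i).symm, hχ.symm⟩ hx,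
    fun hx => Relation.ReflTransGen.head ⟨h, hχ⟩ hx⟩

/-- Pairwise adjacent cubes have a common point. -/
lemma exists_mem_smallCube_of_isBox (hn : 0 < n) {l : List (Fin d → Fin n)}
    (hl : IsBox cubeAdj l) :
    ∃ x : Fin d → ℝ, (∀ i, x i ∈ Set.Icc (0 : ℝ) 1) ∧ ∀ a ∈ l, x ∈ smallCube a := by
  have hn' : (0 : ℝ) < n := by exact_mod_cast hn
  let s : Fin d → ℕ := fun i => l.toFinset.sup fun a : Fin d → Fin n => (a i : ℕ)
  refine ⟨fun i => (s i : ℝ) / n, fun i => ⟨by positivity, ?_⟩, fun a ha => ?_⟩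
  · rw [div_le_one hn']
    exact_mod_cast Finset.sup_le fun (a : Fin d → Fin n) _ => (a i).2.le
  change ∀ i, (s i : ℝ) / n ∈ Set.Icc ((a i : ℝ) / n) (((a i : ℝ) + 1) / n)
  refine fun i => ⟨?_, ?_⟩
  · have : (a i : ℕ) ≤ s i :=
      Finset.le_sup (f := fun a : Fin d → Fin n => (a i : ℕ)) (List.mem_toFinset.2 ha)
    gcongr
  · have : s i ≤ (a i : ℕ) + 1 := Finset.sup_le fun b hb => by
      have := hl a ha b (List.mem_toFinset.1 hb) i
      omega
    gcongr
    exact_mod_cast this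

open Classical in
lemma card_monoComponent_le_of_isBox (hn : 0 < n) {χ : (Fin d → Fin n) → α} {m : ℕ}
    (hχ : ∀ x : Fin d → ℝ, (∀ i, x i ∈ Set.Icc (0 : ℝ) 1) →
      {c : α | ∃ a : Fin d → Fin n, χ a = c ∧ x ∈ smallCube a}.ncard ≤ m + 1)
    {l : List (Fin d → Fin n)} (hl : IsBox cubeAdj l) :
    (l.map (monoComponent χ)).toFinset.card ≤ m + 1 := by
  obtain ⟨x, hx, hxl⟩ := exists_mem_smallCube_of_isBox hn hl
  refine le_trans ?_ (hχ x hx)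
  have hfin : {c : α | ∃ a : Fin d → Fin n, χ a = c ∧ x ∈ smallCube a}.Finite :=
    (Set.finite_range χ).subset fun c ⟨a, ha, _⟩ => ⟨a, ha⟩
  have hex : ∀ K ∈ (l.map (monoComponent χ)).toFinset, ∃ a ∈ l, monoComponent χ a = K := by
    simp
  have : Nonempty (Fin d → Fin n) := ⟨fun _ => ⟨0, hn⟩⟩
  choose! g hgl hg using hex
  rw [← Set.ncard_coe_finset]
  refine Set.ncard_le_ncard_of_injOn (fun K => χ (g K))
    (fun K hK => ⟨g K, rfl, hxl _ (hgl K hK)⟩) (fun K hK K' hK' h => ?_) hfin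
  rw [← hg K hK, ← hg K' hK']
  exact monoComponent_eq_of_adj (hl _ (hgl K hK) _ (hgl K' hK')) h

end Grid

/-- If the `n^d` small cubes of the standard partition of the unit cube `[0,1]^d`
are colored with colors from an arbitrary set in such a way that every point of
`[0,1]^d` lies in closed small cubes of at most `m + 1` distinct colors
(with `m < d`), then some monochromatic connected component contains at least
`f(d, m) · n^(d-m)` small cubes, where `f(d, m) > 0` depends only on `d` and `m`. -/
theorem cube_coloring_large_component_multiplicity (d m : ℕ) (hd : 1 ≤ d) (hm : m < d) :
    ∃ f : ℝ, 0 < f ∧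
      ∀ n : ℕ, 0 < n → ∀ (α : Type) (χ : (Fin d → Fin n) → α),
        (∀ x : Fin d → ℝ, (∀ i, x i ∈ Set.Icc (0 : ℝ) 1) →
          {c : α | ∃ a : Fin d → Fin n, χ a = c ∧ x ∈ smallCube a}.ncard ≤ m + 1) →
        ∃ a : Fin d → Fin n,
          f * (n : ℝ) ^ (d - m) ≤ ((monoComponent χ a).ncard : ℝ) := by
  classical
  set C : ℕ := descentConst (3 ^ d) (3 ^ d) m m * 3 ^ d with hC
  refine ⟨1 / (C + 1), by positivity, fun n hn α χ hχ => ?_⟩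
  have : Nonempty (Fin d → Fin n) := ⟨fun _ => ⟨0, hn⟩⟩
  obtain ⟨K, hK⟩ := exists_large_class isContractionFamily_gridClamp hn
    (Nat.one_le_pow _ _ (by norm_num)) fun l hl => card_monoComponent_le_of_isBox hn hχ hl
  have hpos : 0 < Fintype.card (Fin d → Fin n) := Fintype.card_pos
  have hne : ({a | monoComponent χ a = K} : Finset (Fin d → Fin n)).Nonempty := by
    rw [Finset.nonempty_iff_ne_empty]
    intro h
    rw [h] at hK
    simp at hK
    omega
  obtain ⟨a, ha⟩ := hne
  have ha : monoComponent χ a = K := by simpa using ha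
  refine ⟨a, ?_⟩
  have hle : ({a | monoComponent χ a = K} : Finset (Fin d → Fin n)).card ≤
      (monoComponent χ a).ncard := by
    rw [← Set.ncard_coe_finset]
    refine Set.ncard_le_ncard (fun b hb => ?_) (Set.toFinite _)
    have hb : monoComponent χ b = K := by simpa using hb
    rw [ha, ← hb]
    exact mem_monoComponent_self χ b
  have hmain : n ^ (d - m) ≤ C * (monoComponent χ a).ncard := by
    refine Nat.le_of_mul_le_mul_left (c := n ^ m) ?_ (pow_pos hn m)
    calc n ^ m * n ^ (d - m) = Fintype.card (Fin d → Fin n) := by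
          rw [← pow_add, Nat.add_sub_cancel' hm.le]; simp
      _ ≤ _ := hK
      _ ≤ descentConst (3 ^ d) (3 ^ d) m m * n ^ m * (3 ^ d * (monoComponent χ a).ncard) := by
          gcongr
      _ = _ := by rw [hC]; ring
  have hmain' : (n : ℝ) ^ (d - m) ≤ C * (monoComponent χ a).ncard := by exact_mod_cast hmain
  rw [one_div, inv_mul_le_iff₀ (by positivity)]
  linarith [Nat.cast_nonneg (α := ℝ) (monoComponent χ a).ncard]
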